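/- Fix an integer n ≥ 2 and consider the (unnormalized) instance with n agents and items {o¹_1,…,o¹_n} ∪ {o²_1,…,o²_{n−1}}, where for every agent i: c_i(o¹_i) = K, c_i(o¹_j) = 1 for every j ≠ i, and c_i(o²_j) = n·2^{j−1} for 1 ≤ j ≤ n−1 (so every agent's total cost is K + n·2^{n−1} − 1). Then: (a) the minimum social cost over all allocations equals n·2^{n−1}; and (b) there exists K₀ depending only on n such that for every real K ≥ K₀, every EQX allocation assigns item o¹_i to agent i for each agent i, and therefore every EQX allocation has social cost exactly nK + n·2^{n−1} − n. -/

import Mathlib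

open Finset

/-- `A` is an allocation: the bundles are pairwise disjoint and every item is assigned. -/
def IsAllocation {n : ℕ} {ι : Type*} (A : Fin n → Finset ι) : Prop :=
  (∀ i j : Fin n, i ≠ j → Disjoint (A i) (A j)) ∧ ∀ o : ι, ∃ i : Fin n, o ∈ A i

/-- The social cost of an allocation. -/
def SC {n : ℕ} {ι : Type*} (c : Fin n → ι → ℝ) (A : Fin n → Finset ι) : ℝ :=
  ∑ i, ∑ o ∈ A i, c i o

/-- Equitability up to any item. -/
def EQX {n : ℕ} {ι : Type*} [DecidableEq ι] (c : Fin n → ι → ℝ)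
    (A : Fin n → Finset ι) : Prop :=
  ∀ i j : Fin n, ∀ o ∈ A i, ∑ o' ∈ (A i).erase o, c i o' ≤ ∑ o' ∈ A j, c j o'

/-- The cost function of the EQX worst-case instance.  Items are
`O¹ = Fin n` (left) and `O² = Fin (n-1)` (right, 0-indexed):
agent `i` has cost `K` on `o¹_i`, cost `1` on every other `o¹_j`, and cost `n·2^j`
on the `(j+1)`-st item of `O²`. -/
noncomputable def cEQX8 (n : ℕ) (K : ℝ) (i : Fin n) : Fin n ⊕ Fin (n - 1) → ℝ :=
  Sum.elim (fun j => if j = i then K else 1) (fun j => (n : ℝ) * 2 ^ (j : ℕ))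

/-- Every allocation is described by the function sending each item to its owner. -/
theorem IsAllocation.exists_owner {n : ℕ} {ι : Type*} {A : Fin n → Finset ι}
    (hA : IsAllocation A) : ∃ g : ι → Fin n, ∀ i o, o ∈ A i ↔ g o = i := by
  choose g hg using hA.2
  refine ⟨g, fun i o => ⟨fun h => ?_, fun h => h ▸ hg o⟩⟩
  by_contra hne
  exact disjoint_left.1 (hA.1 _ _ hne) (hg o) h

theorem isAllocation_of_owner {n : ℕ} {ι : Type*} {A : Fin n → Finset ι} {g : ι → Fin n}
    (hg : ∀ i o, o ∈ A i ↔ g o = i) : IsAllocation A := by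
  refine ⟨fun i j hij => disjoint_left.2 fun o hi hj => hij ?_, fun o => ⟨g o, (hg _ _).2 rfl⟩⟩
  rw [← (hg i o).1 hi, (hg j o).1 hj]

theorem SC_eq_sum_owner {n : ℕ} {ι : Type*} [Fintype ι] (c : Fin n → ι → ℝ)
    {A : Fin n → Finset ι} {g : ι → Fin n} (hg : ∀ i o, o ∈ A i ↔ g o = i) :
    SC c A = ∑ o, c (g o) o := by
  classical
  rw [SC, ← sum_fiberwise univ g]
  refine sum_congr rfl fun i _ => ?_
  have h : A i = univ.filter (fun o => g o = i) := by ext o; simp [hg]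
  rw [h]
  refine sum_congr rfl fun o ho => ?_
  rw [(mem_filter.1 ho).2]

/-- In an EQX allocation with nonnegative costs, an item that is not alone in its bundle costs its
owner at most the cost of any other agent's bundle. -/
theorem EQX.cost_le {n : ℕ} {ι : Type*} [DecidableEq ι] {c : Fin n → ι → ℝ}
    {A : Fin n → Finset ι} (h : EQX c A) (hc : ∀ i o, 0 ≤ c i o) {i : Fin n} (j : Fin n) {o x : ι}
    (ho : o ∈ A i) (hx : x ∈ A i) (hne : x ≠ o) : c i o ≤ ∑ o' ∈ A j, c j o' :=
  (single_le_sum (fun y _ => hc i y) (mem_erase.2 ⟨hne.symm, ho⟩)).trans (h i j x hx)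

theorem sum_two_pow_filter_lt_le (N m : ℕ) :
    ∑ k ∈ univ.filter (fun k : Fin N => (k : ℕ) < m), (2 : ℝ) ^ (k : ℕ) ≤ 2 ^ m - 1 := by
  have h : ∑ k ∈ range m, (2 : ℝ) ^ k = 2 ^ m - 1 := by
    rw [geom_sum_eq (by norm_num)]; norm_num
  rw [← h, ← sum_image (s := univ.filter fun k : Fin N => (k : ℕ) < m) (g := Fin.val)
    (f := fun k : ℕ => (2 : ℝ) ^ k) (Fin.val_injective.injOn)]
  refine sum_le_sum_of_subset_of_nonneg ?_ fun _ _ _ => by positivity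
  intro k hk
  simp only [mem_image, mem_filter] at hk
  obtain ⟨a, ha, rfl⟩ := hk
  simpa using ha.2

theorem cEQX8_nonneg (n : ℕ) {K : ℝ} (hK : 0 ≤ K) (i : Fin n) (o : Fin n ⊕ Fin (n - 1)) :
    0 ≤ cEQX8 n K i o := by
  rcases o with j | j
  · simp only [cEQX8, Sum.elim_inl]; split_ifs <;> linarith
  · simp only [cEQX8, Sum.elim_inr]; positivity

/-- A bundle without the agent's own item, all of whose right items have index below `m`, costs
less than the right item of index `m`. -/
theorem sum_cEQX8_le {n : ℕ} {K : ℝ} (hK : 0 ≤ K) {q : Fin n} {S : Finset (Fin n ⊕ Fin (n - 1))}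
    (hq : Sum.inl q ∉ S) {m : ℕ} (hm : ∀ k : Fin (n - 1), Sum.inr k ∈ S → (k : ℕ) < m) :
    ∑ o ∈ S, cEQX8 n K q o ≤ n * 2 ^ m - 1 := by
  have hsub : S ⊆ (univ.erase q).disjSum (univ.filter fun k : Fin (n - 1) => (k : ℕ) < m) := by
    rintro (j | k) ho
    · simp only [inl_mem_disjSum, mem_erase, mem_univ, and_true]
      rintro rfl
      exact hq ho
    · simpa using hm k ho
  refine (sum_le_sum_of_subset_of_nonneg hsub fun o _ _ => cEQX8_nonneg n hK q o).trans ?_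
  have h1 : ∑ j ∈ univ.erase q, cEQX8 n K q (Sum.inl j) = n - 1 := by
    rw [sum_congr rfl (g := fun _ => (1 : ℝ))
      fun j hj => by simp [cEQX8, (mem_erase.1 hj).1]]
    simp [Nat.cast_sub (Fin.pos q)]
  have h2 := mul_le_mul_of_nonneg_left (sum_two_pow_filter_lt_le (n - 1) m)
    (Nat.cast_nonneg (α := ℝ) n)
  rw [mul_sum] at h2
  rw [sum_disjSum, h1]
  simp only [cEQX8, Sum.elim_inr]
  linarith

/-- For large `K`, every EQX allocation gives each agent its own item. -/
theorem owner_inl_eq_of_EQX {n : ℕ} (hn : 2 ≤ n) {K : ℝ} (hK : (n : ℝ) * 2 ^ (n - 1) ≤ K)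
    {A : Fin n → Finset (Fin n ⊕ Fin (n - 1))} {g : Fin n ⊕ Fin (n - 1) → Fin n}
    (hg : ∀ i o, o ∈ A i ↔ g o = i) (hE : EQX (cEQX8 n K) A) (t : Fin n) :
    g (Sum.inl t) = t := by
  by_contra ht
  have hK0 : 0 ≤ K := le_trans (by positivity) hK
  have hle {p : Fin n} (q : Fin n) {o x : Fin n ⊕ Fin (n - 1)} (ho : g o = p) (hx : g x = p)
      (hne : x ≠ o) : cEQX8 n K p o ≤ ∑ o' ∈ A q, cEQX8 n K q o' :=
    hE.cost_le (cEQX8_nonneg n hK0) q ((hg _ _).2 ho) ((hg _ _).2 hx) hne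
  have alone (i : Fin n) (hi : g (Sum.inl i) = i) (x) (hx : g x = i) : x = Sum.inl i := by
    by_contra hne
    have h1 := hle t hi hx hne
    have h2 := sum_cEQX8_le hK0 (mt (hg t (Sum.inl t)).1 ht) (m := n - 1) fun k _ => k.2
    simp only [cEQX8, Sum.elim_inl, if_true] at h1 h2
    linarith
  have larger {p q : Fin n} (hpq : p ≠ q) (hq : g (Sum.inl q) ≠ q) {j : Fin (n - 1)}
      (hj : g (Sum.inr j) = p) {x} (hx : g x = p) (hne : x ≠ Sum.inr j) :
      ∃ k, j < k ∧ g (Sum.inr k) = q := by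
    by_contra! hcon
    have h1 := hle q hj hx hne
    have h2 := sum_cEQX8_le hK0 (mt (hg q (Sum.inl q)).1 hq) (m := j) fun k hk => by
      rw [hg] at hk
      refine lt_of_not_ge fun hjk => ?_
      rcases (Fin.le_def.2 hjk).eq_or_lt with rfl | hlt
      · exact hpq (hj.symm.trans hk)
      · exact hcon k hlt hk
    simp only [cEQX8, Sum.elim_inr] at h1 h2
    linarith
  have moved {s : Fin n} (hs : g (Sum.inl s) ≠ s) :
      g (Sum.inl (g (Sum.inl s))) ≠ g (Sum.inl s) := fun h =>
    hs (Sum.inl_injective (alone _ h _ rfl)).symm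
  have no_right {s : Fin n} (hs : g (Sum.inl s) ≠ s) (j : Fin (n - 1)) :
      g (Sum.inr j) ≠ g (Sum.inl s) := by
    intro hj
    obtain ⟨j, hj, hmax⟩ := exists_max_image
      (univ.filter fun j : Fin (n - 1) => g (Sum.inr j) = g (Sum.inl s)) id ⟨j, by simpa using hj⟩
    simp only [mem_filter, mem_univ, true_and, id] at hj hmax
    have hp := moved hs
    obtain ⟨k, hjk, hk⟩ := larger hp.symm (moved hp) hj rfl Sum.inl_ne_inr
    obtain ⟨l, hkl, hl⟩ := larger hp hp hk rfl Sum.inl_ne_inr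
    exact absurd (hmax l hl) (not_le.2 (hjk.trans hkl))
  have hp := moved ht
  obtain ⟨a, -, b, -, hab, hr⟩ := exists_ne_map_eq_of_card_lt_of_maps_to
    (s := (univ : Finset (Fin (n - 1))))
    (t := (univ.erase (g (Sum.inl t))).erase (g (Sum.inl (g (Sum.inl t)))))
    (f := fun j => g (Sum.inr j))
    (by
      rw [card_erase_of_mem (mem_erase.2 ⟨hp, mem_univ _⟩), card_erase_of_mem (mem_univ _)]
      simp only [card_univ, Fintype.card_fin]
      omega)
    (fun j _ => by simp [no_right ht j, no_right hp j])
  obtain ⟨k, -, hk⟩ := larger (no_right ht a) hp rfl hr.symm (Sum.inr_injective.ne hab.symm)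
  exact no_right ht k hk

theorem eqx_worst_case_instance (n : ℕ) (hn : 2 ≤ n) :
    ∃ K₀ : ℝ, ∀ K : ℝ, K₀ ≤ K →
      ((∃ A : Fin n → Finset (Fin n ⊕ Fin (n - 1)), IsAllocation A ∧
          SC (cEQX8 n K) A = n * 2 ^ (n - 1)) ∧
        (∀ A : Fin n → Finset (Fin n ⊕ Fin (n - 1)), IsAllocation A →
          (n : ℝ) * 2 ^ (n - 1) ≤ SC (cEQX8 n K) A)) ∧
      (∀ A : Fin n → Finset (Fin n ⊕ Fin (n - 1)), IsAllocation A → EQX (cEQX8 n K) A →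
        (∀ i : Fin n, Sum.inl i ∈ A i) ∧
          SC (cEQX8 n K) A = n * K + n * 2 ^ (n - 1) - n) := by
  refine ⟨n * 2 ^ (n - 1), fun K hK => ?_⟩
  have hK1 : 1 ≤ K := by
    refine le_trans ?_ hK
    have h1 : (1 : ℝ) ≤ n := by exact_mod_cast (by omega : 1 ≤ n)
    exact one_le_mul_of_one_le_of_one_le h1 (one_le_pow₀ (by norm_num))
  have hSC {A : Fin n → Finset (Fin n ⊕ Fin (n - 1))} {g : Fin n ⊕ Fin (n - 1) → Fin n}
      (hg : ∀ i o, o ∈ A i ↔ g o = i) :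
      SC (cEQX8 n K) A =
        (∑ j, if j = g (Sum.inl j) then K else 1) + n * (2 ^ (n - 1) - 1) := by
    rw [SC_eq_sum_owner _ hg, Fintype.sum_sum_type]
    simp only [cEQX8, Sum.elim_inl, Sum.elim_inr]
    rw [← mul_sum, Fin.sum_univ_eq_sum_range (fun k => (2 : ℝ) ^ k), geom_sum_eq (by norm_num)]
    norm_num
  refine ⟨⟨?_, fun A hA => ?_⟩, fun A hA hE => ?_⟩
  · have : Nontrivial (Fin n) := Fin.nontrivial_iff_two_le.2 hn
    choose f hf using fun j : Fin n => exists_ne j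
    let g : Fin n ⊕ Fin (n - 1) → Fin n := Sum.elim f fun _ => ⟨0, by omega⟩
    have hg : ∀ i o, o ∈ univ.filter (fun o => g o = i) ↔ g o = i := by simp
    refine ⟨fun i => univ.filter fun o => g o = i, isAllocation_of_owner hg, ?_⟩
    rw [hSC hg]
    simp only [g, Sum.elim_inl, (hf _).symm, if_false, sum_const, card_univ, Fintype.card_fin,
      nsmul_eq_mul]
    ring
  · obtain ⟨g, hg⟩ := hA.exists_owner
    rw [hSC hg]
    have h : ∑ _j : Fin n, (1 : ℝ) ≤ ∑ j, if j = g (Sum.inl j) then K else 1 :=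
      sum_le_sum fun j _ => by split_ifs <;> linarith
    simp only [sum_const, card_univ, Fintype.card_fin, nsmul_eq_mul] at h
    linarith
  · obtain ⟨g, hg⟩ := hA.exists_owner
    have hown := owner_inl_eq_of_EQX hn hK hg hE
    refine ⟨fun i => (hg _ _).2 (hown i), ?_⟩
    rw [hSC hg]
    simp only [hown, if_true, sum_const, card_univ, Fintype.card_fin, nsmul_eq_mul]
    ring
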